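/- Let n be a natural number, let a > 0, let f : ℂ → ℂ be complex-differentiable on the open ball B(0,a), and assume that z ↦ ‖f(z)‖² is integrable on B(0,a). Then for every z with ‖z‖ ≤ 2^{−1/(n+1)} · a, one has ‖ ∫_{t ∈ [0,1]} f(t·z) · z dt ‖ ≤ ‖f‖_{L²(B_a)} · log( 2·(n+1) ). -/

import Mathlib

open Complex Metric MeasureTheory

/-- **Sub-mean value inequality** for the area mean of a holomorphic function on a disc. -/
theorem enorm_mul_volume_ball_le_lintegral {g : ℂ → ℂ} {c : ℂ} {r : ℝ}
    (hg : DifferentiableOn ℂ g (ball c r)) :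
    ‖g c‖ₑ * volume (ball c r) ≤ ∫⁻ w in ball c r, ‖g w‖ₑ := by
  set G : ℂ → ENNReal := (ball c r).indicator fun w => ‖g w‖ₑ with hG
  have hGm : Measurable G := by
    classical
    rw [hG, ← Set.piecewise_eq_indicator]
    exact ContinuousOn.measurable_piecewise hg.continuousOn.enorm continuousOn_const
      measurableSet_ball
  set κ : ENNReal := ENNReal.ofReal (2 * Real.pi) with hκ
  have hκ0 : κ ≠ 0 := by simp [hκ, Real.pi_pos]
  have hκt : κ ≠ ⊤ := ENNReal.ofReal_ne_top
  have hpt (u : ℂ) : (ball (0 : ℂ) r).indicator (fun _ => κ * ‖g c‖ₑ) u ≤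
      ∫⁻ θ in Set.Ioc 0 (2 * Real.pi), G (c + u * circleMap 0 1 θ) := by
    by_cases hu : u ∈ ball (0 : ℂ) r
    swap
    · simp [hu]
    have hu' : ‖u‖ < r := by simpa using hu
    have hmaps : Set.MapsTo (fun z => c + u * z) (closedBall 0 1) (ball c r) := by
      intro z hz
      have hz' : ‖z‖ ≤ 1 := by simpa using hz
      simp only [mem_ball, dist_eq_norm, add_sub_cancel_left, norm_mul]
      nlinarith [norm_nonneg u, norm_nonneg z]
    have hd : DifferentiableOn ℂ (fun z => g (c + u * z)) (closedBall 0 1) :=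
      hg.comp (by fun_prop) hmaps
    have hmean : Real.circleAverage (fun z => g (c + u * z)) 0 1 = g c := by
      have := DiffContOnCl.circleAverage (f := fun z => g (c + u * z)) (c := 0) (R := 1)
        (DifferentiableOn.diffContOnCl (by simpa [closure_ball] using hd))
      simpa using this
    rw [Set.indicator_of_mem hu]
    have hint : (∫ θ in Set.Ioc 0 (2 * Real.pi), g (c + u * circleMap 0 1 θ)) =
        (2 * Real.pi) • g c := by
      rw [← hmean, Real.circleAverage_def, intervalIntegral.integral_of_le Real.two_pi_pos.le,
        smul_smul, mul_inv_cancel₀ Real.two_pi_pos.ne', one_smul]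
    calc κ * ‖g c‖ₑ = ‖(2 * Real.pi) • g c‖ₑ := by
          rw [enorm_smul, hκ, Real.enorm_of_nonneg Real.two_pi_pos.le]
      _ ≤ ∫⁻ θ in Set.Ioc 0 (2 * Real.pi), ‖g (c + u * circleMap 0 1 θ)‖ₑ := by
          rw [← hint]; exact enorm_integral_le_lintegral_enorm _
      _ = ∫⁻ θ in Set.Ioc 0 (2 * Real.pi), G (c + u * circleMap 0 1 θ) := by
          refine lintegral_congr fun θ => ?_
          rw [hG, Set.indicator_of_mem (hmaps _)]
          simp [circleMap]
  have hrot (θ : ℝ) : ∫⁻ u, G (c + u * circleMap 0 1 θ) = ∫⁻ w in ball c r, ‖g w‖ₑ := by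
    have hmp : MeasurePreserving (rotation (Circle.exp θ)) (volume : Measure ℂ) volume :=
      LinearIsometryEquiv.measurePreserving _
    have h := hmp.lintegral_comp (f := fun u => G (c + u)) (by fun_prop)
    rw [lintegral_add_left_eq_self G c] at h
    rw [← lintegral_indicator measurableSet_ball, ← hG, ← h]
    simp [rotation_apply, circleMap, Circle.coe_exp, mul_comm]
  have hvol : volume (ball (0 : ℂ) r) = volume (ball c r) := by
    simp [Complex.volume_ball]
  have key := lintegral_mono (μ := volume) hpt
  rw [lintegral_indicator_const measurableSet_ball, lintegral_lintegral_swap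
    (Measurable.aemeasurable (by unfold Function.uncurry; fun_prop [circleMap]))] at key
  simp only [hrot, setLIntegral_const, Real.volume_Ioc, sub_zero, hvol] at key
  rw [mul_assoc, mul_comm _ (ENNReal.ofReal _)] at key
  exact (ENNReal.mul_le_mul_iff_right hκ0 hκt).1 key

/-- Pointwise bound for square-integrable holomorphic functions on a disc. -/
theorem norm_mul_sub_norm_le_sqrt_integral {f : ℂ → ℂ} {a : ℝ}
    (hf : DifferentiableOn ℂ f (ball (0 : ℂ) a))
    (hf2 : IntegrableOn (fun z => ‖f z‖ ^ 2) (ball (0 : ℂ) a)) {w : ℂ} (hw : ‖w‖ < a) :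
    ‖f w‖ * (a - ‖w‖) ≤ Real.sqrt (∫ z in ball (0 : ℂ) a, ‖f z‖ ^ 2) := by
  have hsub : ball w (a - ‖w‖) ⊆ ball 0 a := ball_subset_ball' (by simp)
  have h1 := (enorm_mul_volume_ball_le_lintegral (hf.mono hsub |>.pow 2)).trans
    (lintegral_mono_set hsub)
  have h2 : ∫⁻ z in ball (0 : ℂ) a, ‖(f ^ 2) z‖ₑ =
      ENNReal.ofReal (∫ z in ball (0 : ℂ) a, ‖f z‖ ^ 2) := by
    rw [ofReal_integral_eq_lintegral_ofReal hf2 (.of_forall fun _ => by positivity)]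
    refine lintegral_congr fun z => ?_
    rw [← ofReal_norm, Pi.pow_apply, norm_pow]
  have hpos : 0 < a - ‖w‖ := sub_pos.2 hw
  have hI : 0 ≤ ∫ z in ball (0 : ℂ) a, ‖f z‖ ^ 2 := integral_nonneg fun _ => by positivity
  rw [h2, Complex.volume_ball, ← ofReal_norm, Pi.pow_apply, norm_pow,
    ← ENNReal.ofReal_pow hpos.le, ← ENNReal.ofReal_coe_nnreal, NNReal.coe_real_pi,
    ← ENNReal.ofReal_mul (by positivity), ← ENNReal.ofReal_mul (by positivity),
    ENNReal.ofReal_le_ofReal_iff hI] at h1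
  refine Real.le_sqrt_of_sq_le (le_trans ?_ h1)
  rw [mul_pow]
  gcongr
  nlinarith [Real.pi_gt_three, sq_nonneg (a - ‖w‖)]

/-- `2 ^ (-1 / (n + 1)) ≤ 1 - 1 / (2 * (n + 1))`, from Bernoulli's inequality. -/
theorem two_rpow_neg_one_div_le (n : ℕ) :
    (2 : ℝ) ^ (-(1 : ℝ) / (n + 1)) ≤ 1 - 1 / (2 * (n + 1)) := by
  have hn : (0 : ℝ) < n + 1 := by positivity
  have h := rpow_one_add_le_one_add_mul_self (s := -(1 / 2)) (by norm_num)
    (p := 1 / ((n : ℝ) + 1)) (by positivity) (by rw [div_le_one hn]; simp)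
  rw [neg_div, Real.rpow_neg zero_le_two, ← Real.inv_rpow zero_le_two]
  convert h using 1
  · norm_num
  · field_simp
    ring

/-- Local form of (eq:int-beta1): for `f` holomorphic on `ball 0 a` with `‖f‖²` integrable,
and `‖z‖ ≤ 2^{-1/(n+1)} a`, the segment integral satisfies
`‖∫₀¹ f(tz)·z dt‖ ≤ ‖f‖_{L²(B_a)} log(2(n+1))`. -/
theorem segment_integral_le_log_two_mul (n : ℕ) (a : ℝ) (ha : 0 < a) (f : ℂ → ℂ)
    (hf : DifferentiableOn ℂ f (ball (0 : ℂ) a))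
    (hf2 : IntegrableOn (fun z => ‖f z‖ ^ 2) (ball (0 : ℂ) a)) :
    ∀ z : ℂ, ‖z‖ ≤ (2 : ℝ) ^ (-(1 : ℝ) / (n + 1)) * a →
      ‖∫ t in (0:ℝ)..1, f ((t : ℂ) * z) * z‖ ≤
        Real.sqrt (∫ w in ball (0 : ℂ) a, ‖f w‖ ^ 2) * Real.log (2 * (n + 1)) := by
  intro z hz
  set M := Real.sqrt (∫ w in ball (0 : ℂ) a, ‖f w‖ ^ 2) with hM
  have hn : (0 : ℝ) < n + 1 := by positivity
  have hza : a ≤ 2 * (n + 1) * (a - ‖z‖) := by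
    have h := hz.trans (mul_le_mul_of_nonneg_right (two_rpow_neg_one_div_le n) ha.le)
    have hmul : 2 * ((n : ℝ) + 1) * ‖z‖ ≤ 2 * (n + 1) * ((1 - 1 / (2 * (n + 1))) * a) := by gcongr
    have hexp : 2 * ((n : ℝ) + 1) * ((1 - 1 / (2 * (n + 1))) * a) = 2 * (n + 1) * a - a := by
      field_simp
    linarith
  have hlt : ‖z‖ < a := sub_pos.1 (pos_of_mul_pos_right (ha.trans_le hza) (by positivity))
  have hpos (t : ℝ) (ht : t ∈ Set.Icc (0 : ℝ) 1) : 0 < a - t * ‖z‖ := by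
    nlinarith [ht.1, ht.2, norm_nonneg z]
  have hderiv (t : ℝ) (ht : t ∈ Set.uIcc (0 : ℝ) 1) :
      HasDerivAt (fun t => -(M * Real.log (a - t * ‖z‖))) (M * (‖z‖ / (a - t * ‖z‖))) t := by
    rw [Set.uIcc_of_le zero_le_one] at ht
    have h := ((((hasDerivAt_id t).mul_const ‖z‖).const_sub a).log (hpos t ht).ne').const_mul M
    refine h.neg.congr_deriv ?_
    simp [neg_div]
  have hint : IntervalIntegrable (fun t => M * (‖z‖ / (a - t * ‖z‖))) volume 0 1 := by
    refine ContinuousOn.intervalIntegrable ?_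
    rw [Set.uIcc_of_le zero_le_one]
    exact continuousOn_const.mul
      (continuousOn_const.div (by fun_prop) fun t ht => (hpos t ht).ne')
  calc ‖∫ t in (0:ℝ)..1, f ((t : ℂ) * z) * z‖
      ≤ ∫ t in (0:ℝ)..1, M * (‖z‖ / (a - t * ‖z‖)) := by
        refine intervalIntegral.norm_integral_le_of_norm_le zero_le_one
          (.of_forall fun t ht => ?_) hint
        have ht' : t ∈ Set.Icc (0 : ℝ) 1 := Set.Ioc_subset_Icc_self ht
        have hnorm : ‖(t : ℂ) * z‖ = t * ‖z‖ := by
          rw [norm_mul, Complex.norm_of_nonneg ht'.1]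
        have h := norm_mul_sub_norm_le_sqrt_integral hf hf2 (w := t * z)
          (by rw [hnorm]; linarith [hpos t ht'])
        rw [hnorm, ← le_div_iff₀ (hpos t ht')] at h
        rw [norm_mul, mul_div_left_comm, mul_comm]
        gcongr
    _ = M * (Real.log a - Real.log (a - ‖z‖)) := by
        rw [intervalIntegral.integral_eq_sub_of_hasDerivAt hderiv hint]
        simp
        ring
    _ ≤ M * Real.log (2 * (n + 1)) := by
        have hsub := sub_pos.2 hlt
        rw [← Real.log_div ha.ne' hsub.ne']
        gcongr
        exact (div_le_iff₀ hsub).2 hza
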